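/- (Final value theorem for the fractional Hankel transform, classical form.) Let 3/2 < η < 2 + μ with μ ≥ -1/2, α ∈ (0,π), c₁ = cot α, c₂ = csc α. Suppose f : (0,∞) → ℂ is such that x^{μ+1/2} f(x) is Lebesgue integrable on every interval (0,X) with X < ∞, and there is δ ∈ ℂ with lim_{x→∞} e^{-i x² c₁/2} x^{η-1/2} f(x) = δ · c₂^{3/2-η}/C_{α,μ}. Then lim_{ξ→0⁺} e^{i ξ² c₁/2} ξ^{3/2-η} H^α_μ f(ξ) = δ · H(μ,η), where H(μ,η) = Γ(1 + μ/2 - η/2)/(2^{η-1} Γ(μ/2 + η/2)). -/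

import Mathlib

open MeasureTheory Filter Set

/-- Bessel function of the first kind of order `μ`. -/
noncomputable def besselJ (μ x : ℝ) : ℝ :=
  (x / 2) ^ μ *
    ∑' n : ℕ, ((-1 : ℝ) ^ n / ((n.factorial : ℝ) * Real.Gamma (μ + n + 1))) * (x / 2) ^ (2 * n)

/-- The constant `C_{α,μ} = e^{i(1+μ)(π/2-α)}/ sin α`. -/
noncomputable def Cst (α μ : ℝ) : ℂ :=
  Complex.exp (Complex.I * ((1 + μ) * (Real.pi / 2 - α) : ℝ)) / (Real.sin α : ℂ)

/-- The fractional Hankel transform kernel (for `α ≠ π/2`),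
`K_α(x,ξ) = C_{α,μ} e^{-i(x²+ξ²)c₁/2} √(xξc₂) J_μ(xξc₂)` with `c₁ = cot α`, `c₂ = csc α`. -/
noncomputable def frhtKernel (α μ x ξ : ℝ) : ℂ :=
  Cst α μ * Complex.exp (-Complex.I * (((x ^ 2 + ξ ^ 2) / 2 * Real.cot α : ℝ) : ℂ)) *
    ((Real.sqrt (x * ξ * (Real.sin α)⁻¹) * besselJ μ (x * ξ * (Real.sin α)⁻¹) : ℝ) : ℂ)

/-- The fractional Hankel transform of a function. -/
noncomputable def frht (α μ : ℝ) (f : ℝ → ℂ) (ξ : ℝ) : ℂ :=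
  ∫ x in Set.Ioi (0 : ℝ), frhtKernel α μ x ξ * f x

/-- The classical Hankel transform of order `μ`. -/
noncomputable def hankel (μ : ℝ) (g : ℝ → ℂ) (ξ : ℝ) : ℂ :=
  ∫ x in Set.Ioi (0 : ℝ), ((Real.sqrt (x * ξ) * besselJ μ (x * ξ) : ℝ) : ℂ) * g x

/-- `H(μ,η) = Γ(1+μ/2-η/2)/(2^{η-1} Γ(μ/2+η/2))`. -/
noncomputable def Hconst (μ η : ℝ) : ℝ :=
  Real.Gamma (1 + μ / 2 - η / 2) / (2 ^ (η - 1) * Real.Gamma (μ / 2 + η / 2))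

/-- `L` is slowly varying at the origin. -/
def SlowlyVaryingAtZero (L : ℝ → ℝ) : Prop :=
  ∀ a > 0, Filter.Tendsto (fun ε => L (a * ε) / L ε) (nhdsWithin 0 (Set.Ioi 0)) (nhds 1)


/-- The Bessel–Clifford function, `∑ (-1)ⁿ zⁿ / (n! Γ(ν + n + 1))`. -/
noncomputable def besselClifford (ν z : ℝ) : ℝ :=
  ∑' n : ℕ, (-1 : ℝ) ^ n / ((n.factorial : ℝ) * Real.Gamma (ν + n + 1)) * z ^ n

theorem besselJ_eq (μ x : ℝ) :
    besselJ μ x = (x / 2) ^ μ * besselClifford μ ((x / 2) ^ 2) := by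
  simp only [besselJ, besselClifford, pow_mul]

theorem gamma_add_nat_pos {ν : ℝ} (hν : -1 < ν) (n : ℕ) : 0 < Real.Gamma (ν + n + 1) :=
  Real.Gamma_pos_of_pos (by have : (0 : ℝ) ≤ n := n.cast_nonneg; linarith)

theorem summable_besselClifford {ν : ℝ} (hν : -1 < ν) (z : ℝ) :
    Summable fun n : ℕ => (-1 : ℝ) ^ n / ((n.factorial : ℝ) * Real.Gamma (ν + n + 1)) * z ^ n := by
  obtain rfl | hz := eq_or_ne z 0
  · exact summable_of_ne_finset_zero (s := {0}) (fun n hn => by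
      simp at hn; simp [hn])
  refine summable_of_ratio_test_tendsto_lt_one zero_lt_one ?_ ?_
  · refine Eventually.of_forall fun n => ?_
    have := (gamma_add_nat_pos hν n).ne'
    have := n.factorial_ne_zero
    positivity
  · have hlim : Tendsto (fun n : ℕ => |z| * ((1 : ℝ) / ((n : ℝ) + 1) * (ν + n + 1)⁻¹)) atTop
        (nhds (|z| * (0 * 0))) := by
      refine (tendsto_one_div_add_atTop_nhds_zero_nat.mul ?_).const_mul _
      refine tendsto_inv_atTop_zero.comp ?_
      exact tendsto_atTop_add_const_right _ _
        (tendsto_atTop_add_const_left _ _ tendsto_natCast_atTop_atTop)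
    rw [mul_zero, mul_zero] at hlim
    refine hlim.congr fun n => ?_
    have hG := gamma_add_nat_pos hν n
    have hp : 0 < ν + n + 1 := by have : (0 : ℝ) ≤ n := n.cast_nonneg; linarith
    have hrec : Real.Gamma (ν + (n + 1 : ℕ) + 1) = (ν + n + 1) * Real.Gamma (ν + n + 1) := by
      rw [← Real.Gamma_add_one hp.ne']; push_cast; ring_nf
    have hf := Nat.cast_pos (α := ℝ).2 n.factorial_pos
    have hz' := abs_pos.2 hz
    rw [hrec, Nat.factorial_succ]
    simp only [norm_mul, norm_div, norm_pow, norm_neg, norm_one, one_pow, Real.norm_eq_abs,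
      abs_of_pos hG, abs_of_pos hp, Nat.cast_mul, Nat.abs_cast]
    push_cast
    field_simp
    ring

theorem hasDerivAt_besselClifford {ν : ℝ} (hν : -1 < ν) (z : ℝ) :
    HasDerivAt (besselClifford ν) (-besselClifford (ν + 1) z) z := by
  have key : ∀ (n : ℕ) (y : ℝ),
      (-1 : ℝ) ^ (n + 1) / (((n + 1).factorial : ℝ) * Real.Gamma (ν + (n + 1 : ℕ) + 1)) *
        (((n + 1 : ℕ) : ℝ) * y ^ n) =
      -((-1 : ℝ) ^ n / ((n.factorial : ℝ) * Real.Gamma (ν + 1 + n + 1)) * y ^ n) := by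
    intro n y
    have hG := (gamma_add_nat_pos (ν := ν + 1) (by linarith) n).ne'
    have hf := Nat.cast_ne_zero (R := ℝ).2 n.factorial_ne_zero
    rw [show ν + (n + 1 : ℕ) + 1 = ν + 1 + n + 1 by push_cast; ring, Nat.factorial_succ]
    have : ((n : ℝ) + 1) ≠ 0 := by positivity
    push_cast
    field_simp
    ring
  have hsum := fun y => summable_besselClifford (ν := ν + 1) (by linarith) y
  have hsum' : ∀ y : ℝ, HasSum (fun n : ℕ =>
      (-1 : ℝ) ^ n / ((n.factorial : ℝ) * Real.Gamma (ν + n + 1)) * ((n : ℝ) * y ^ (n - 1)))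
      (-besselClifford (ν + 1) y) := by
    intro y
    rw [← hasSum_nat_add_iff' 1]
    simp only [key, Nat.add_sub_cancel, Finset.range_one, Finset.sum_singleton, Nat.cast_zero,
      zero_mul, mul_zero, sub_zero]
    exact (hsum y).hasSum.neg
  rw [← (hsum' z).tsum_eq]
  refine hasDerivAt_tsum_of_isPreconnected (t := Metric.ball 0 (|z| + 1)) (y₀ := z)
    (u := fun n : ℕ => ‖(-1 : ℝ) ^ n / ((n.factorial : ℝ) * Real.Gamma (ν + n + 1)) *
      ((n : ℝ) * (|z| + 1) ^ (n - 1))‖)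
    (hsum' (|z| + 1)).summable.norm Metric.isOpen_ball
    (convex_ball _ _).isPreconnected
    (fun n y _ => (hasDerivAt_pow n y).const_mul _) ?_ ?_ (summable_besselClifford hν z) ?_
  · intro n y hy
    simp only [mem_ball_zero_iff, Real.norm_eq_abs] at hy
    simp only [norm_mul, norm_pow, Real.norm_eq_abs]
    rw [abs_of_nonneg (a := |z| + 1) (by positivity)]
    gcongr
  · simp
  · simp

theorem besselClifford_recurrence {ν : ℝ} (hν : -1 < ν) (z : ℝ) :
    besselClifford ν z =
      (ν + 1) * besselClifford (ν + 1) z - z * besselClifford (ν + 2) z := by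
  have h0 := (summable_besselClifford hν z).hasSum
  have h1 := (summable_besselClifford (ν := ν + 1) (by linarith) z).hasSum.mul_left (ν + 1)
  have h2 := (summable_besselClifford (ν := ν + 2) (by linarith) z).hasSum.mul_left z
  have h3 : HasSum (fun n : ℕ => (-1 : ℝ) ^ n / ((n.factorial : ℝ) * Real.Gamma (ν + 1 + n + 1)) *
      ((n : ℝ) * z ^ n)) (-(z * besselClifford (ν + 2) z)) := by
    rw [← hasSum_nat_add_iff' 1]
    simp only [Finset.range_one, Finset.sum_singleton, Nat.cast_zero, zero_mul, mul_zero, sub_zero]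
    refine h2.neg.congr_fun fun n => ?_
    have hG := (gamma_add_nat_pos (ν := ν + 2) (by linarith) n).ne'
    have hf := Nat.cast_ne_zero (R := ℝ).2 n.factorial_ne_zero
    rw [show ν + 1 + (n + 1 : ℕ) + 1 = ν + 2 + n + 1 by push_cast; ring, Nat.factorial_succ]
    have : ((n : ℝ) + 1) ≠ 0 := by positivity
    push_cast
    field_simp
    ring
  rw [sub_eq_add_neg]
  refine h0.unique ((h1.add h3).congr_fun fun n => ?_)
  have hp : 0 < ν + n + 1 := by have : (0 : ℝ) ≤ n := n.cast_nonneg; linarith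
  have hG := (gamma_add_nat_pos hν n).ne'
  have hf := Nat.cast_ne_zero (R := ℝ).2 n.factorial_ne_zero
  rw [show ν + 1 + n + 1 = (ν + n + 1) + 1 by ring, Real.Gamma_add_one hp.ne']
  have := hp.ne'
  field_simp
  ring

theorem continuous_besselClifford {ν : ℝ} (hν : -1 < ν) : Continuous (besselClifford ν) :=
  continuous_iff_continuousAt.2 fun z => (hasDerivAt_besselClifford hν z).continuousAt

theorem sqrt_mul_besselJ_eq (μ : ℝ) {t : ℝ} (ht : 0 < t) :
    √t * besselJ μ t = 2 ^ (-μ) * (t ^ (μ + 1 / 2) * besselClifford μ ((t / 2) ^ 2)) := by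
  rw [besselJ_eq, Real.div_rpow ht.le zero_le_two, Real.sqrt_eq_rpow, Real.rpow_add ht,
    Real.rpow_neg zero_le_two]
  ring

theorem hasDerivAt_besselClifford_sq {ν : ℝ} (hν : -1 < ν) (t : ℝ) :
    HasDerivAt (fun t => besselClifford ν ((t / 2) ^ 2))
      (-(t / 2) * besselClifford (ν + 1) ((t / 2) ^ 2)) t := by
  have h : HasDerivAt (fun t : ℝ => (t / 2) ^ 2) (t / 2) t := by
    refine (((hasDerivAt_id t).div_const 2).pow 2).congr_deriv ?_
    simp only [id]
    ring
  refine ((hasDerivAt_besselClifford hν _).comp t h).congr_deriv ?_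
  ring

theorem hasDerivAt_rpow_mul_besselClifford {μ : ℝ} (hμ : -1 < μ) {t : ℝ} (ht : 0 < t) :
    HasDerivAt (fun t => t ^ (μ + 1 / 2) * besselClifford μ ((t / 2) ^ 2))
      (t ^ (μ + 1 / 2) * ((μ + 1 / 2) / t * besselClifford μ ((t / 2) ^ 2) -
        t / 2 * besselClifford (μ + 1) ((t / 2) ^ 2))) t := by
  refine ((Real.hasDerivAt_rpow_const (p := μ + 1 / 2) (Or.inl ht.ne')).mul
    (hasDerivAt_besselClifford_sq hμ t)).congr_deriv ?_
  rw [Real.rpow_sub_one ht.ne']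
  field_simp
  ring

/-- The second derivative of `u = t ^ (μ + 1 / 2) * besselClifford μ (t ^ 2 / 4)`, a multiple of
`√t * J_μ(t)`, satisfies `u'' = -(1 - (μ ^ 2 - 1 / 4) / t ^ 2) u`. -/
theorem hasDerivAt_deriv_rpow_mul_besselClifford {μ : ℝ} (hμ : -1 < μ) {t : ℝ} (ht : 0 < t) :
    HasDerivAt (fun t => t ^ (μ + 1 / 2) * ((μ + 1 / 2) / t * besselClifford μ ((t / 2) ^ 2) -
        t / 2 * besselClifford (μ + 1) ((t / 2) ^ 2)))
      (-(1 - (μ ^ 2 - 1 / 4) / t ^ 2) *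
        (t ^ (μ + 1 / 2) * besselClifford μ ((t / 2) ^ 2))) t := by
  have h := (Real.hasDerivAt_rpow_const (p := μ + 1 / 2) (Or.inl ht.ne')).mul
    ((((hasDerivAt_inv ht.ne').const_mul (μ + 1 / 2)).mul (hasDerivAt_besselClifford_sq hμ t)).sub
      (((hasDerivAt_id t).div_const 2).mul
        (hasDerivAt_besselClifford_sq (ν := μ + 1) (by linarith) t)))
  refine h.congr_deriv ?_
  have hrec := besselClifford_recurrence hμ ((t / 2) ^ 2)
  rw [show μ + 1 + 1 = μ + 2 by ring, Real.rpow_sub_one ht.ne']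
  simp only [id, Pi.mul_apply, Pi.sub_apply]
  generalize t ^ (μ + 1 / 2) = P
  generalize besselClifford (μ + 1) ((t / 2) ^ 2) = B₁ at *
  generalize besselClifford (μ + 2) ((t / 2) ^ 2) = B₂ at *
  simp only [hrec]
  field_simp
  ring

theorem exists_bound_rpow_mul_besselClifford {μ : ℝ} (hμ : -1 < μ) :
    ∃ M, ∀ t, 1 ≤ t → |t ^ (μ + 1 / 2) * besselClifford μ ((t / 2) ^ 2)| ≤ M := by
  set u : ℝ → ℝ := fun t => t ^ (μ + 1 / 2) * besselClifford μ ((t / 2) ^ 2) with hu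
  set v : ℝ → ℝ := fun t => t ^ (μ + 1 / 2) * ((μ + 1 / 2) / t * besselClifford μ ((t / 2) ^ 2) -
        t / 2 * besselClifford (μ + 1) ((t / 2) ^ 2)) with hv
  set c := |μ ^ 2 - 1 / 4| with hc
  have hE : ∀ t, 0 < t → HasDerivAt (fun t => (u t ^ 2 + v t ^ 2) * Real.exp (c * t⁻¹))
      ((2 * (μ ^ 2 - 1 / 4) * (u t * v t) - c * (u t ^ 2 + v t ^ 2)) / t ^ 2 *
        Real.exp (c * t⁻¹)) t := by
    intro t ht
    have h1 : HasDerivAt u (v t) t := hasDerivAt_rpow_mul_besselClifford hμ ht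
    have h2 : HasDerivAt v (-(1 - (μ ^ 2 - 1 / 4) / t ^ 2) * u t) t :=
      hasDerivAt_deriv_rpow_mul_besselClifford hμ ht
    refine (((h1.pow 2).add (h2.pow 2)).mul
      ((hasDerivAt_inv ht.ne').const_mul c).exp).congr_deriv ?_
    simp only [Pi.add_apply, Pi.pow_apply]
    field_simp
    push_cast
    ring
  have hanti : AntitoneOn (fun t => (u t ^ 2 + v t ^ 2) * Real.exp (c * t⁻¹)) (Ici 1) := by
    refine antitoneOn_of_deriv_nonpos (convex_Ici 1)
      (fun t ht => (hE t (by linarith [mem_Ici.1 ht])).continuousAt.continuousWithinAt)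
      (fun t ht => ?_) (fun t ht => ?_)
    all_goals
      rw [interior_Ici, mem_Ioi] at ht
      have hd := hE t (by linarith)
    · exact hd.differentiableAt.differentiableWithinAt
    · rw [hd.deriv]
      refine mul_nonpos_of_nonpos_of_nonneg (div_nonpos_of_nonpos_of_nonneg ?_ (sq_nonneg t))
        (Real.exp_pos _).le
      have h1 : (μ ^ 2 - 1 / 4) * (u t * v t) ≤ c * (|u t| * |v t|) := by
        rw [hc, ← abs_mul, ← abs_mul]; exact le_abs_self _
      have h2 : 0 ≤ c * (|u t| - |v t|) ^ 2 := mul_nonneg (abs_nonneg _) (sq_nonneg _)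
      rw [← sq_abs (u t), ← sq_abs (v t)]
      linear_combination 2 * h1 + h2
  refine ⟨√((u 1 ^ 2 + v 1 ^ 2) * Real.exp (c * 1⁻¹)), fun t ht => Real.abs_le_sqrt ?_⟩
  have h1 := hanti (mem_Ici.2 le_rfl) (mem_Ici.2 ht) ht
  have h2 : 1 ≤ Real.exp (c * t⁻¹) := Real.one_le_exp (by positivity)
  have h3 : u t ^ 2 + v t ^ 2 ≤ (u t ^ 2 + v t ^ 2) * Real.exp (c * t⁻¹) :=
    le_mul_of_one_le_right (by positivity) h2
  have h4 := sq_nonneg (v t)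
  exact (by linarith : u t ^ 2 ≤ u t ^ 2 + v t ^ 2).trans (h3.trans h1)

theorem exists_bound_sqrt_mul_besselJ {μ : ℝ} (hμ : -1 / 2 ≤ μ) :
    ∃ M, 0 ≤ M ∧ ∀ t, 0 < t →
      |√t * besselJ μ t| ≤ M ∧ |√t * besselJ μ t| ≤ M * t ^ (μ + 1 / 2) := by
  obtain ⟨M₁, hM₁⟩ := exists_bound_rpow_mul_besselClifford (μ := μ) (by linarith)
  obtain ⟨M₂, hM₂⟩ := isCompact_Icc.exists_bound_of_continuousOn (s := Icc (0 : ℝ) 1)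
    (f := fun t => besselClifford μ ((t / 2) ^ 2))
    ((continuous_besselClifford (by linarith)).comp (by fun_prop)).continuousOn
  have h₁ : 0 ≤ M₁ := (abs_nonneg _).trans (hM₁ 1 le_rfl)
  have h₂ : 0 ≤ M₂ := (norm_nonneg _).trans (hM₂ 0 (by simp))
  have hm : 0 ≤ μ + 1 / 2 := by linarith
  have h2 : (0 : ℝ) < 2 ^ (-μ) := by positivity
  refine ⟨2 ^ (-μ) * max M₁ M₂, by positivity, fun t ht => ?_⟩
  rw [sqrt_mul_besselJ_eq μ ht, abs_mul, abs_of_pos h2]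
  simp only [mul_assoc]
  have hp := Real.rpow_pos_of_pos ht (μ + 1 / 2)
  rcases le_total t 1 with h | h
  · have hb : |t ^ (μ + 1 / 2) * besselClifford μ ((t / 2) ^ 2)| ≤
        max M₁ M₂ * t ^ (μ + 1 / 2) := by
      rw [abs_mul, abs_of_pos hp, mul_comm]
      gcongr
      exact (hM₂ t ⟨ht.le, h⟩).trans (le_max_right _ _)
    have hle : t ^ (μ + 1 / 2) ≤ 1 := Real.rpow_le_one ht.le h hm
    refine ⟨?_, ?_⟩ <;> gcongr
    exact hb.trans (mul_le_of_le_one_right (by positivity) hle)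
  · have hb := (hM₁ t h).trans (le_max_left M₁ M₂)
    have hle : 1 ≤ t ^ (μ + 1 / 2) := Real.one_le_rpow h hm
    refine ⟨?_, ?_⟩ <;> gcongr
    exact hb.trans (le_mul_of_one_le_right (by positivity) hle)

theorem measurable_besselJ {μ : ℝ} (hμ : -1 < μ) : Measurable (besselJ μ) := by
  have h : besselJ μ = fun x => (x / 2) ^ μ * besselClifford μ ((x / 2) ^ 2) :=
    funext (besselJ_eq μ)
  rw [h]
  have := (continuous_besselClifford hμ).measurable
  fun_prop

theorem integral_rpow_mul_besselJ_mul_exp_neg_mul_sq {μ p : ℝ} (hμ : -1 < μ) (hp : 0 < p) :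
    ∫ x in Ioi (0 : ℝ), x ^ (μ + 1) * besselJ μ x * Real.exp (-p * x ^ 2) =
      (2 * p) ^ (-(μ + 1)) * Real.exp (-(1 / (4 * p))) := by
  set c : ℕ → ℝ := fun n => (-1 : ℝ) ^ n / ((n.factorial : ℝ) * Real.Gamma (μ + n + 1)) with hc
  set F : ℕ → ℝ → ℝ := fun n x =>
    2 ^ (-μ) * (c n * (1 / 4) ^ n) * (x ^ (2 * μ + 2 * n + 1) * Real.exp (-p * x ^ 2)) with hF
  have hq : ∀ n : ℕ, -1 < 2 * μ + 2 * n + 1 := fun n => by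
    have : (0 : ℝ) ≤ n := n.cast_nonneg
    linarith
  have hFint : ∀ n, Integrable (F n) (volume.restrict (Ioi 0)) := fun n =>
    (integrableOn_rpow_mul_exp_neg_mul_sq hp (hq n)).const_mul _
  have hmom : ∀ n : ℕ, ∫ x in Ioi (0 : ℝ), x ^ (2 * μ + 2 * n + 1) * Real.exp (-p * x ^ 2) =
      p ^ (-(μ + 1)) * (1 / p) ^ n * (1 / 2) * Real.Gamma (μ + n + 1) := by
    intro n
    have h := integral_rpow_mul_exp_neg_mul_rpow two_pos (hq n) hp
    simp only [Real.rpow_two] at h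
    rw [h, show -(2 * μ + 2 * n + 1 + 1) / 2 = -(μ + 1) - n by ring,
      show (2 * μ + 2 * n + 1 + 1) / 2 = μ + n + 1 by ring, Real.rpow_sub hp, Real.rpow_natCast]
    simp [div_eq_mul_inv]
  have h2 : (2 * p) ^ (-(μ + 1)) = 2 ^ (-μ) * p ^ (-(μ + 1)) * (1 / 2) := by
    rw [Real.mul_rpow zero_le_two hp.le, show -(μ + 1) = -μ - 1 by ring,
      Real.rpow_sub_one two_ne_zero]
    ring
  have hval : ∀ n, ∫ x in Ioi (0 : ℝ), F n x =
      (2 * p) ^ (-(μ + 1)) * ((-(1 / (4 * p))) ^ n / n.factorial) := by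
    intro n
    have hG := (gamma_add_nat_pos hμ n).ne'
    have hf := Nat.cast_ne_zero (R := ℝ).2 n.factorial_ne_zero
    rw [integral_const_mul, hmom, h2, show -(1 / (4 * p)) = -1 * (1 / 4) * (1 / p) by ring,
      mul_pow, mul_pow, hc]
    field_simp
  have hnorm : ∀ n, ∫ x in Ioi (0 : ℝ), ‖F n x‖ =
      (2 * p) ^ (-(μ + 1)) * ((1 / (4 * p)) ^ n / n.factorial) := by
    intro n
    have hG := gamma_add_nat_pos hμ n
    have : ∀ x ∈ Ioi (0 : ℝ), ‖F n x‖ = 2 ^ (-μ) *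
        (1 / ((n.factorial : ℝ) * Real.Gamma (μ + n + 1)) * (1 / 4) ^ n) *
        (x ^ (2 * μ + 2 * n + 1) * Real.exp (-p * x ^ 2)) := by
      intro x hx
      have hx' := Real.rpow_pos_of_pos (mem_Ioi.1 hx) (2 * μ + 2 * n + 1)
      have h2' : (0 : ℝ) < 2 ^ (-μ) := by positivity
      simp [hF, hc, abs_of_pos hx', abs_of_pos h2', abs_of_pos hG]
    have hf := Nat.cast_ne_zero (R := ℝ).2 n.factorial_ne_zero
    rw [setIntegral_congr_fun measurableSet_Ioi this, integral_const_mul, hmom, h2,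
      show 1 / (4 * p) = (1 / 4) * (1 / p) by ring, mul_pow]
    field_simp
  have hsum := hasSum_integral_of_summable_integral_norm hFint (by
    simp only [hnorm]
    exact (Real.summable_pow_div_factorial _).mul_left _)
  have hexp := (NormedSpace.expSeries_div_hasSum_exp (-(1 / (4 * p)))).mul_left
    ((2 * p) ^ (-(μ + 1)))
  rw [← Real.exp_eq_exp_ℝ] at hexp
  simp only [hval] at hsum
  rw [← hsum.unique hexp]
  refine setIntegral_congr_fun measurableSet_Ioi fun x hx => ?_
  have hx : 0 < x := hx
  have hterm : ∀ n, F n x = 2 ^ (-μ) * x ^ (2 * μ + 1) * Real.exp (-p * x ^ 2) *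
      (c n * ((x / 2) ^ 2) ^ n) := by
    intro n
    simp only [hF]
    rw [show 2 * μ + 2 * n + 1 = (2 * μ + 1) + (2 * n : ℕ) by push_cast; ring,
      Real.rpow_add_natCast hx.ne', pow_mul, show (x / 2) ^ 2 = 1 / 4 * x ^ 2 by ring, mul_pow]
    ring
  have hxp : x ^ (2 * μ + 1) = x ^ (μ + 1) * x ^ μ := by
    rw [← Real.rpow_add hx]
    congr 1
    ring
  simp only [hterm]
  rw [tsum_mul_left, besselJ_eq, show ∑' n, c n * ((x / 2) ^ 2) ^ n =
    besselClifford μ ((x / 2) ^ 2) from rfl, Real.div_rpow hx.le zero_le_two,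
    Real.rpow_neg zero_le_two, hxp]
  ring

theorem integral_rpow_mul_exp_neg_one_div {b r : ℝ} (hb : 0 < b) (hr : 0 < r) :
    ∫ p in Ioi (0 : ℝ), p ^ (-b - 1) * Real.exp (-(r / p)) = (1 / r) ^ b * Real.Gamma b := by
  rw [← Real.integral_rpow_mul_exp_neg_mul_Ioi hb hr,
    ← integral_comp_rpow_Ioi (fun t => t ^ (b - 1) * Real.exp (-(r * t)))
      (by norm_num : (-1 : ℝ) ≠ 0)]
  refine setIntegral_congr_fun measurableSet_Ioi fun p hp => ?_
  have hp : 0 < p := hp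
  simp only [smul_eq_mul, abs_neg, abs_one, one_mul]
  rw [← Real.rpow_mul hp.le, Real.rpow_neg_one, ← mul_assoc, ← Real.rpow_add hp]
  congr 2
  ring

theorem integrableOn_rpow_mul_besselJ {μ η : ℝ} (hμ : -1 / 2 ≤ μ) (hη1 : 3 / 2 < η)
    (hη2 : η < 2 + μ) :
    IntegrableOn (fun x => x ^ (1 / 2 - η) * (√x * besselJ μ x)) (Ioi 0) := by
  obtain ⟨M, -, hM⟩ := exists_bound_sqrt_mul_besselJ hμ
  have hmeas : Measurable (fun x => x ^ (1 / 2 - η) * (√x * besselJ μ x)) := by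
    have := measurable_besselJ (μ := μ) (by linarith)
    fun_prop
  rw [← Ioc_union_Ioi_eq_Ioi zero_le_one]
  refine IntegrableOn.union ?_ ?_
  · have h : IntegrableOn (fun x : ℝ => M * x ^ (1 + μ - η)) (Ioc 0 1) :=
      ((intervalIntegral.intervalIntegrable_rpow' (a := 0) (b := 1)
        (by linarith : -1 < 1 + μ - η)).1).const_mul M
    refine h.mono' hmeas.aestronglyMeasurable
      ((ae_restrict_iff' measurableSet_Ioc).2 (.of_forall fun x hx => ?_))
    rw [norm_mul, Real.norm_of_nonneg (Real.rpow_nonneg hx.1.le _),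
      show 1 + μ - η = (1 / 2 - η) + (μ + 1 / 2) by ring, Real.rpow_add hx.1, mul_left_comm]
    exact mul_le_mul_of_nonneg_left (hM x hx.1).2 (Real.rpow_nonneg hx.1.le _)
  · have h : IntegrableOn (fun x : ℝ => M * x ^ (1 / 2 - η)) (Ioi 1) :=
      (integrableOn_Ioi_rpow_of_lt (by linarith) one_pos).const_mul M
    refine h.mono' hmeas.aestronglyMeasurable
      ((ae_restrict_iff' measurableSet_Ioi).2 (.of_forall fun x hx => ?_))
    have hx0 : 0 < x := one_pos.trans hx
    rw [norm_mul, Real.norm_of_nonneg (Real.rpow_nonneg hx0.le _), mul_comm M]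
    exact mul_le_mul_of_nonneg_left (hM x hx0).1 (Real.rpow_nonneg hx0.le _)

/-- Weber's integral `∫₀^∞ x ^ (1 - η) J_μ(x) dx`. -/
theorem integral_rpow_mul_besselJ {μ η : ℝ} (hμ : -1 / 2 ≤ μ) (hη1 : 3 / 2 < η)
    (hη2 : η < 2 + μ) :
    ∫ x in Ioi (0 : ℝ), x ^ (1 / 2 - η) * (√x * besselJ μ x) = Hconst μ η := by
  have hμ1 : -1 < μ := by linarith
  have ha : 0 < (η + μ) / 2 := by linarith
  have hint := integrableOn_rpow_mul_besselJ hμ hη1 hη2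
  set a := (η + μ) / 2 with ha_def
  set F : ℝ → ℝ → ℝ := fun x p =>
    x ^ (μ + 1) * besselJ μ x * (p ^ (a - 1) * Real.exp (-(x ^ 2 * p))) with hF
  have hgauss : ∀ x : ℝ, 0 < x → IntegrableOn
      (fun p : ℝ => p ^ (a - 1) * Real.exp (-(x ^ 2 * p))) (Ioi 0) := by
    intro x hx
    have := integrableOn_rpow_mul_exp_neg_mul_rpow (p := 1) (s := a - 1) (b := x ^ 2)
      (by linarith) one_pos (by positivity)
    simpa using this
  have hpow : ∀ x : ℝ, 0 < x → x ^ (μ + 1) * besselJ μ x * ((1 / x ^ 2) ^ a * Real.Gamma a) =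
      Real.Gamma a * (x ^ (1 / 2 - η) * (√x * besselJ μ x)) := by
    intro x hx
    rw [one_div, ← Real.rpow_natCast x 2, ← Real.rpow_neg hx.le, ← Real.rpow_mul hx.le,
      Real.sqrt_eq_rpow]
    have : x ^ (μ + 1) * x ^ (-((2 : ℕ) : ℝ) * a) = x ^ (1 / 2 - η) * x ^ (1 / 2 : ℝ) := by
      rw [← Real.rpow_add hx, ← Real.rpow_add hx]
      congr 1
      push_cast
      rw [ha_def]
      ring
    linear_combination besselJ μ x * Real.Gamma a * this
  have hG : 0 < Real.Gamma a := Real.Gamma_pos_of_pos ha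
  have hFmeas : Measurable (Function.uncurry F) := by
    have := measurable_besselJ hμ1
    simp only [hF, Function.uncurry_def]
    fun_prop
  have hFint : Integrable (Function.uncurry F)
      ((volume.restrict (Ioi 0)).prod (volume.restrict (Ioi 0))) := by
    refine (integrable_prod_iff hFmeas.aestronglyMeasurable).2 ⟨?_, ?_⟩
    · exact (ae_restrict_iff' measurableSet_Ioi).2
        (.of_forall fun x hx => (hgauss x hx).const_mul (x ^ (μ + 1) * besselJ μ x))
    · refine (hint.norm.const_mul (Real.Gamma a)).congr
        ((ae_restrict_iff' measurableSet_Ioi).2 (.of_forall fun x hx => ?_))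
      have hx : 0 < x := hx
      have h1 : ∀ p ∈ Ioi (0 : ℝ), ‖Function.uncurry F (x, p)‖ =
          ‖x ^ (μ + 1) * besselJ μ x‖ * (p ^ (a - 1) * Real.exp (-(x ^ 2 * p))) := by
        intro p hp
        have hp' := Real.rpow_pos_of_pos (mem_Ioi.1 hp) (a - 1)
        simp only [hF, Function.uncurry]
        rw [norm_mul, Real.norm_of_nonneg (by positivity :
          0 ≤ p ^ (a - 1) * Real.exp (-(x ^ 2 * p)))]
      dsimp only
      rw [setIntegral_congr_fun measurableSet_Ioi h1, integral_const_mul,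
        Real.integral_rpow_mul_exp_neg_mul_Ioi ha (by positivity),
        ← Real.norm_of_nonneg (by positivity : 0 ≤ (1 / x ^ 2) ^ a * Real.Gamma a), ← norm_mul,
        hpow x hx, norm_mul (Real.Gamma a), Real.norm_of_nonneg hG.le]
  have hswap := integral_integral_swap hFint
  have hleft : ∫ x in Ioi (0 : ℝ), ∫ p in Ioi (0 : ℝ), F x p =
      Real.Gamma a * ∫ x in Ioi (0 : ℝ), x ^ (1 / 2 - η) * (√x * besselJ μ x) := by
    rw [← integral_const_mul]
    refine setIntegral_congr_fun measurableSet_Ioi fun x hx => ?_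
    have hx : 0 < x := hx
    simp only [hF]
    rw [integral_const_mul, Real.integral_rpow_mul_exp_neg_mul_Ioi ha (by positivity), hpow x hx]
  have hb : 0 < 1 + μ / 2 - η / 2 := by linarith
  have hright : ∫ p in Ioi (0 : ℝ), ∫ x in Ioi (0 : ℝ), F x p =
      2 ^ (-(μ + 1)) * ((1 / (1 / 4)) ^ (1 + μ / 2 - η / 2) *
        Real.Gamma (1 + μ / 2 - η / 2)) := by
    rw [← integral_rpow_mul_exp_neg_one_div hb (by norm_num), ← integral_const_mul]
    refine setIntegral_congr_fun measurableSet_Ioi fun p hp => ?_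
    have hp : 0 < p := hp
    have h1 : ∀ x ∈ Ioi (0 : ℝ), F x p =
        p ^ (a - 1) * (x ^ (μ + 1) * besselJ μ x * Real.exp (-p * x ^ 2)) := by
      intro x _
      simp only [hF]
      rw [show -(x ^ 2 * p) = -p * x ^ 2 by ring]
      ring
    rw [setIntegral_congr_fun measurableSet_Ioi h1, integral_const_mul,
      integral_rpow_mul_besselJ_mul_exp_neg_mul_sq hμ1 hp, Real.mul_rpow zero_le_two hp.le,
      show -(1 + μ / 2 - η / 2) - 1 = (a - 1) + -(μ + 1) by rw [ha_def]; ring, Real.rpow_add hp,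
      show 1 / 4 / p = 1 / (4 * p) by field_simp]
    ring
  rw [hleft, hright] at hswap
  have h4 : (1 / (1 / 4) : ℝ) ^ (1 + μ / 2 - η / 2) = 2 ^ (2 + μ - η) := by
    rw [show (1 / (1 / 4) : ℝ) = 2 ^ (2 : ℝ) by norm_num, ← Real.rpow_mul zero_le_two]
    congr 1
    ring
  rw [h4, ← mul_assoc, ← Real.rpow_add two_pos,
    show -(μ + 1) + (2 + μ - η) = -(η - 1) by ring, Real.rpow_neg zero_le_two] at hswap
  rw [Hconst, show μ / 2 + η / 2 = a by rw [ha_def]; ring, eq_div_iff (by positivity)]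
  have : (2 : ℝ) ^ (η - 1) ≠ 0 := by positivity
  generalize ∫ x in Ioi (0 : ℝ), x ^ (1 / 2 - η) * (√x * besselJ μ x) = I at hswap ⊢
  generalize Real.Gamma (1 + μ / 2 - η / 2) = G at hswap ⊢
  field_simp at hswap
  linear_combination hswap

theorem norm_le_mul_rpow_of_norm_rpow_mul_le {η K x : ℝ} {z : ℂ} (hx : 0 < x)
    (h : ‖((x ^ (η - 1 / 2) : ℝ) : ℂ) * z‖ ≤ K) : ‖z‖ ≤ K * x ^ (1 / 2 - η) := by
  rw [norm_mul, Complex.norm_of_nonneg (Real.rpow_nonneg hx.le _)] at h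
  rw [show 1 / 2 - η = -(η - 1 / 2) by ring, Real.rpow_neg hx.le, ← div_eq_mul_inv,
    le_div_iff₀ (Real.rpow_pos_of_pos hx _), mul_comm]
  exact h

/-- Final value theorem for the classical Hankel transform. -/
theorem tendsto_rpow_mul_hankel {μ η : ℝ} (hμ : -1 / 2 ≤ μ) (hη1 : 3 / 2 < η) (hη2 : η < 2 + μ)
    {g : ℝ → ℂ} {A : ℂ} (hg : Measurable g)
    (hint : ∀ X > (0 : ℝ),
      IntegrableOn (fun x => ((x ^ (μ + 1 / 2) : ℝ) : ℂ) * g x) (Ioo 0 X))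
    (hlim : Tendsto (fun x : ℝ => ((x ^ (η - 1 / 2) : ℝ) : ℂ) * g x) atTop (nhds A)) :
    Tendsto (fun s : ℝ => ((s ^ (3 / 2 - η) : ℝ) : ℂ) * hankel μ g s) (nhdsWithin 0 (Ioi 0))
      (nhds (A * (Hconst μ η : ℂ))) := by
  obtain ⟨M, hM0, hM⟩ := exists_bound_sqrt_mul_besselJ hμ
  set k : ℝ → ℝ := fun t => √t * besselJ μ t with hk
  have hkmeas : Measurable k := by
    have := measurable_besselJ (μ := μ) (by linarith)
    fun_prop
  obtain ⟨X, hX0, hX⟩ : ∃ X > (0 : ℝ), ∀ x ≥ X,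
      ‖((x ^ (η - 1 / 2) : ℝ) : ℂ) * g x‖ ≤ ‖A‖ + 1 := by
    have h := (hlim.norm.eventually_le_const (lt_add_one ‖A‖)).and (eventually_gt_atTop 0)
    obtain ⟨X, hX⟩ := eventually_atTop.1 h
    exact ⟨X, (hX X le_rfl).2, fun x hx => (hX x hx).1⟩
  have hfar : ∀ x, X ≤ x → ‖g x‖ ≤ (‖A‖ + 1) * x ^ (1 / 2 - η) := fun x hx =>
    norm_le_mul_rpow_of_norm_rpow_mul_le (hX0.trans_le hx) (hX x hx)
  have hkg : ∀ s : ℝ, Measurable fun x => ((k (x * s) : ℝ) : ℂ) * g x := fun s => by fun_prop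
  have hintX := ((integrableOn_Ioc_iff_integrableOn_Ioo enorm_ne_top).2 (hint X hX0)).norm
  have hbound_near : ∀ s > 0, ∀ x ∈ Ioc 0 X, ‖((k (x * s) : ℝ) : ℂ) * g x‖ ≤
      M * s ^ (μ + 1 / 2) * ‖((x ^ (μ + 1 / 2) : ℝ) : ℂ) * g x‖ := by
    intro s hs x hx
    rw [norm_mul, norm_mul, Complex.norm_of_nonneg (Real.rpow_nonneg hx.1.le _),
      Complex.norm_real, Real.norm_eq_abs, ← mul_assoc]
    gcongr
    refine (hM _ (mul_pos hx.1 hs)).2.trans_eq ?_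
    rw [Real.mul_rpow hx.1.le hs.le]
    ring
  have hnear_int : ∀ s > 0, IntegrableOn (fun x => ((k (x * s) : ℝ) : ℂ) * g x) (Ioc 0 X) :=
    fun s hs => (hintX.const_mul (M * s ^ (μ + 1 / 2))).mono' (hkg s).aestronglyMeasurable
      ((ae_restrict_iff' measurableSet_Ioc).2 (.of_forall (hbound_near s hs)))
  have hfar_int : ∀ s > 0, IntegrableOn (fun x => ((k (x * s) : ℝ) : ℂ) * g x) (Ioi X) := by
    intro s hs
    have h : IntegrableOn (fun x : ℝ => M * ((‖A‖ + 1) * x ^ (1 / 2 - η))) (Ioi X) :=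
      ((integrableOn_Ioi_rpow_of_lt (by linarith) hX0).const_mul _).const_mul _
    refine h.mono' (hkg s).aestronglyMeasurable
      ((ae_restrict_iff' measurableSet_Ioi).2 (.of_forall fun x hx => ?_))
    rw [norm_mul, Complex.norm_real, Real.norm_eq_abs]
    exact mul_le_mul (hM _ (mul_pos (hX0.trans hx) hs)).1 (hfar x (le_of_lt hx)) (norm_nonneg _) hM0
  have hnear : Tendsto (fun s : ℝ => ((s ^ (3 / 2 - η) : ℝ) : ℂ) *
      ∫ x in Ioc 0 X, ((k (x * s) : ℝ) : ℂ) * g x) (nhdsWithin 0 (Ioi 0)) (nhds 0) := by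
    have h0 : Tendsto (fun s : ℝ => s ^ (2 + μ - η) *
        (M * ∫ x in Ioc 0 X, ‖((x ^ (μ + 1 / 2) : ℝ) : ℂ) * g x‖)) (nhdsWithin 0 (Ioi 0))
        (nhds 0) := by
      have h := (Real.continuousAt_rpow_const 0 (2 + μ - η) (Or.inr (by linarith))).tendsto.mono_left
        (nhdsWithin_le_nhds (s := Ioi 0))
      rw [Real.zero_rpow (by linarith)] at h
      simpa using h.mul_const (M * ∫ x in Ioc 0 X, ‖((x ^ (μ + 1 / 2) : ℝ) : ℂ) * g x‖)
    refine squeeze_zero_norm' ?_ h0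
    filter_upwards [self_mem_nhdsWithin] with s hs
    have hs : 0 < s := hs
    have h1 : ‖∫ x in Ioc 0 X, ((k (x * s) : ℝ) : ℂ) * g x‖ ≤
        M * s ^ (μ + 1 / 2) * ∫ x in Ioc 0 X, ‖((x ^ (μ + 1 / 2) : ℝ) : ℂ) * g x‖ := by
      rw [← integral_const_mul]
      exact norm_integral_le_of_norm_le (hintX.const_mul _)
        ((ae_restrict_iff' measurableSet_Ioc).2 (.of_forall (hbound_near s hs)))
    rw [norm_mul, Complex.norm_of_nonneg (Real.rpow_nonneg hs.le _),
      show 2 + μ - η = (3 / 2 - η) + (μ + 1 / 2) by ring, Real.rpow_add hs]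
    refine (mul_le_mul_of_nonneg_left h1 (Real.rpow_nonneg hs.le _)).trans_eq ?_
    ring
  have hfar_lim : Tendsto (fun s : ℝ => ((s ^ (3 / 2 - η) : ℝ) : ℂ) *
      ∫ x in Ioi X, ((k (x * s) : ℝ) : ℂ) * g x) (nhdsWithin 0 (Ioi 0))
      (nhds (A * (Hconst μ η : ℂ))) := by
    set F : ℝ → ℝ → ℂ := fun s => (Ioi (X * s)).indicator
      fun t => ((k t * s ^ (1 / 2 - η) : ℝ) : ℂ) * g (t / s) with hF
    have hlim_eq : ∫ t in Ioi (0 : ℝ), ((t ^ (1 / 2 - η) * k t : ℝ) : ℂ) * A =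
        A * (Hconst μ η : ℂ) := by
      rw [integral_mul_const, integral_complex_ofReal, integral_rpow_mul_besselJ hμ hη1 hη2,
        mul_comm]
    have hF_eq : ∀ s ∈ Ioi (0 : ℝ), ∫ t in Ioi (0 : ℝ), F s t =
        ((s ^ (3 / 2 - η) : ℝ) : ℂ) * ∫ x in Ioi X, ((k (x * s) : ℝ) : ℂ) * g x := by
      intro s hs
      have hs : 0 < s := hs
      have h := integral_comp_mul_right_Ioi' (fun t => ((k t : ℝ) : ℂ) * g (t / s)) X hs
      simp only [mul_div_cancel_right₀ _ hs.ne'] at h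
      rw [setIntegral_indicator measurableSet_Ioi,
        inter_eq_right.2 (Ioi_subset_Ioi (mul_pos hX0 hs).le),
        show (3 / 2 - η) = (1 / 2 - η) + 1 by ring, Real.rpow_add_one hs.ne', Complex.ofReal_mul,
        mul_assoc, ← Complex.real_smul (x := s), h, ← integral_const_mul]
      congr 1 with t
      push_cast
      ring
    rw [← hlim_eq]
    refine (tendsto_integral_filter_of_dominated_convergence (F := F)
      (fun t => (‖A‖ + 1) * ‖t ^ (1 / 2 - η) * k t‖) ?_ ?_
      ((integrableOn_rpow_mul_besselJ hμ hη1 hη2).norm.const_mul _) ?_).congr' ?_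
    · refine .of_forall fun s => ?_
      exact (Measurable.indicator (by fun_prop) measurableSet_Ioi).aestronglyMeasurable
    · filter_upwards [self_mem_nhdsWithin] with s hs
      have hs : 0 < s := hs
      refine (ae_restrict_iff' measurableSet_Ioi).2 (.of_forall fun t ht => ?_)
      have ht : 0 < t := ht
      by_cases hts : t ∈ Ioi (X * s)
      · simp only [hF, indicator_of_mem hts]
        have h := hfar (t / s) ((le_div_iff₀ hs).2 (le_of_lt hts))
        rw [norm_mul, Complex.norm_real, norm_mul (k t), norm_mul (t ^ (1 / 2 - η)),
          Real.norm_of_nonneg (Real.rpow_nonneg hs.le _),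
          Real.norm_of_nonneg (Real.rpow_nonneg ht.le _)]
        rw [Real.div_rpow ht.le hs.le] at h
        have hsp := Real.rpow_pos_of_pos hs (1 / 2 - η)
        refine (mul_le_mul_of_nonneg_left h (by positivity)).trans_eq ?_
        field_simp
      · simp only [hF, indicator_of_notMem hts, norm_zero]
        positivity
    · refine (ae_restrict_iff' measurableSet_Ioi).2 (.of_forall fun t ht => ?_)
      have ht : 0 < t := ht
      have hdiv : Tendsto (fun s : ℝ => t / s) (nhdsWithin 0 (Ioi 0)) atTop := by
        simpa only [div_eq_mul_inv] using tendsto_inv_nhdsGT_zero.const_mul_atTop ht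
      refine ((hlim.comp hdiv).const_mul ((t ^ (1 / 2 - η) * k t : ℝ) : ℂ)).congr' ?_
      filter_upwards [self_mem_nhdsWithin, hdiv.eventually_gt_atTop X] with s hs hts
      have hs : 0 < s := hs
      have hmem : t ∈ Ioi (X * s) := (lt_div_iff₀ hs).1 hts
      simp only [hF, indicator_of_mem hmem, Function.comp]
      rw [← mul_assoc, ← Complex.ofReal_mul]
      congr 2
      rw [show η - 1 / 2 = -(1 / 2 - η) by ring, Real.rpow_neg (div_pos ht hs).le,
        Real.div_rpow ht.le hs.le]
      have h1 := Real.rpow_pos_of_pos hs (1 / 2 - η)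
      have h2 := Real.rpow_pos_of_pos ht (1 / 2 - η)
      field_simp
    · filter_upwards [self_mem_nhdsWithin] with s hs using hF_eq s hs
  have hsum := hnear.add hfar_lim
  rw [zero_add] at hsum
  refine hsum.congr' ?_
  filter_upwards [self_mem_nhdsWithin] with s hs
  rw [← mul_add, ← setIntegral_union Ioc_disjoint_Ioi_same measurableSet_Ioi (hnear_int s hs)
    (hfar_int s hs), Ioc_union_Ioi_eq_Ioi hX0.le]
  rfl

theorem exp_mul_frht_eq (α μ : ℝ) (f : ℝ → ℂ) (ξ : ℝ) :
    Complex.exp (Complex.I * ((ξ ^ 2 * Real.cot α / 2 : ℝ) : ℂ)) * frht α μ f ξ =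
      Cst α μ * hankel μ
        (fun x => Complex.exp (-Complex.I * ((x ^ 2 * Real.cot α / 2 : ℝ) : ℂ)) * f x)
        (ξ * (Real.sin α)⁻¹) := by
  rw [frht, hankel, ← integral_const_mul, ← integral_const_mul]
  congr 1 with x
  have h : Complex.exp (-Complex.I * (((x ^ 2 + ξ ^ 2) / 2 * Real.cot α : ℝ) : ℂ)) =
      Complex.exp (-Complex.I * ((x ^ 2 * Real.cot α / 2 : ℝ) : ℂ)) *
        (Complex.exp (Complex.I * ((ξ ^ 2 * Real.cot α / 2 : ℝ) : ℂ)))⁻¹ := by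
    rw [← Complex.exp_neg, ← Complex.exp_add]
    congr 1
    push_cast
    ring
  have hne := Complex.exp_ne_zero (Complex.I * ((ξ ^ 2 * Real.cot α / 2 : ℝ) : ℂ))
  rw [frhtKernel, h, ← mul_assoc x ξ]
  field_simp

/-- Final value theorem for the fractional Hankel transform, classical form. -/
theorem frht_final_value_classical
    (μ η α : ℝ) (hμ : -1/2 ≤ μ) (hη1 : 3/2 < η) (hη2 : η < 2 + μ)
    (hα1 : 0 < α) (hα2 : α < Real.pi) (hα3 : α ≠ Real.pi / 2)
    (f : ℝ → ℂ) (δ : ℂ)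
    (hmeas : Measurable f)
    (hint : ∀ X > (0 : ℝ),
      MeasureTheory.IntegrableOn (fun x => ((x ^ (μ + 1/2) : ℝ) : ℂ) * f x) (Set.Ioo 0 X))
    (hlim : Filter.Tendsto
      (fun x : ℝ => Complex.exp (-Complex.I * ((x ^ 2 * Real.cot α / 2 : ℝ) : ℂ)) *
        ((x ^ (η - 1/2) : ℝ) : ℂ) * f x)
      Filter.atTop
      (nhds (δ * ((((Real.sin α)⁻¹) ^ (3/2 - η) : ℝ) : ℂ) / Cst α μ))) :
    Filter.Tendsto
      (fun ξ : ℝ => Complex.exp (Complex.I * ((ξ ^ 2 * Real.cot α / 2 : ℝ) : ℂ)) *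
        ((ξ ^ (3/2 - η) : ℝ) : ℂ) * frht α μ f ξ)
      (nhdsWithin 0 (Set.Ioi 0)) (nhds (δ * (Hconst μ η : ℂ))) := by
  have hsin : 0 < (Real.sin α)⁻¹ := inv_pos.2 (Real.sin_pos_of_pos_of_lt_pi hα1 hα2)
  have hC : Cst α μ ≠ 0 := div_ne_zero (Complex.exp_ne_zero _)
    (Complex.ofReal_ne_zero.2 (inv_pos.1 hsin).ne')
  set c := (Real.sin α)⁻¹ with hc
  have hH := tendsto_rpow_mul_hankel hμ hη1 hη2
    (g := fun x => Complex.exp (-Complex.I * ((x ^ 2 * Real.cot α / 2 : ℝ) : ℂ)) * f x)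
    (A := δ * ((c ^ (3/2 - η) : ℝ) : ℂ) / Cst α μ) (by fun_prop) ?_ ?_
  · have hs : Tendsto (fun ξ : ℝ => ξ * c) (nhdsWithin 0 (Ioi 0)) (nhdsWithin 0 (Ioi 0)) := by
      refine tendsto_nhdsWithin_iff.2 ⟨?_, ?_⟩
      · have : Tendsto (fun ξ : ℝ => ξ * c) (nhds 0) (nhds (0 * c)) :=
          tendsto_id.mul_const c
        rw [zero_mul] at this
        exact this.mono_left nhdsWithin_le_nhds
      · filter_upwards [self_mem_nhdsWithin] with ξ hξ using mul_pos hξ hsin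
    have hcp : ((c ^ (3/2 - η) : ℝ) : ℂ) ≠ 0 :=
      Complex.ofReal_ne_zero.2 (Real.rpow_pos_of_pos hsin _).ne'
    convert! ((hH.comp hs).const_mul (Cst α μ / ((c ^ (3/2 - η) : ℝ) : ℂ))).congr' ?_ using 2
    · generalize ((c ^ (3/2 - η) : ℝ) : ℂ) = w at hcp ⊢
      field_simp
    · filter_upwards [self_mem_nhdsWithin] with ξ hξ
      have hξ : 0 < ξ := hξ
      rw [mul_right_comm, exp_mul_frht_eq, Function.comp, Real.mul_rpow hξ.le hsin.le,
        Complex.ofReal_mul]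
      generalize ((c ^ (3/2 - η) : ℝ) : ℂ) = w at hcp ⊢
      generalize hankel μ _ (ξ * c) = h
      field_simp
  · intro X hX
    refine Integrable.mono (hint X hX) (by fun_prop) (.of_forall fun x => ?_)
    have h : ‖Complex.exp (-Complex.I * ((x ^ 2 * Real.cot α / 2 : ℝ) : ℂ))‖ = 1 := by
      rw [neg_mul, mul_comm, ← neg_mul, ← Complex.ofReal_neg, Complex.norm_exp_ofReal_mul_I]
    rw [norm_mul, norm_mul, norm_mul, h, one_mul]
  · refine hlim.congr fun x => ?_
    ring
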